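/- Let n ≥ 2 and let ν be an even, finite Borel measure on S^{n−1} with ν(S^{n−1}) > 0 that satisfies the strict subspace concentration inequality. Fix α ≠ 0 and let F be a positive, continuous, α-homogeneous functional on convex bodies of ℝⁿ satisfying properties (A) and (B). Then there exists K₀ ∈ 𝒦ⁿ_e with F(K₀) = ν(S^{n−1}) such that Φ_ν(K₀) ≤ Φ_ν(Q) for every Q ∈ 𝒦ⁿ_e with F(Q) = ν(S^{n−1}); that is, the infimum of Φ_ν over {Q ∈ 𝒦ⁿ_e : F(Q) = ν(S^{n−1})} is attained. -/

import Mathlib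

open MeasureTheory Filter Topology
open scoped InnerProductSpace ENNReal Pointwise

noncomputable section

/-- The unit sphere `S^{n-1}` of `ℝⁿ`. -/
def unitSphere (n : ℕ) : Set (EuclideanSpace ℝ (Fin n)) := Metric.sphere 0 1

/-- A convex body: compact, convex, with nonempty interior. -/
def IsConvexBody {n : ℕ} (K : Set (EuclideanSpace ℝ (Fin n))) : Prop :=
  IsCompact K ∧ Convex ℝ K ∧ (interior K).Nonempty

/-- The support function `h_K(u) = sup_{y ∈ K} ⟨y, u⟩`. -/
def suppFn {n : ℕ} (K : Set (EuclideanSpace ℝ (Fin n))) (u : EuclideanSpace ℝ (Fin n)) : ℝ :=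
  sSup ((fun y => ⟪y, u⟫_ℝ) '' K)

/-- The log-functional `Φ_ν(Q) = ∫ log h_Q dν`. -/
def logFunc {n : ℕ} (ν : Measure (EuclideanSpace ℝ (Fin n)))
    (Q : Set (EuclideanSpace ℝ (Fin n))) : ℝ :=
  ∫ u, Real.log (suppFn Q u) ∂ν

theorem exists_ne_zero_forall_inner_eq_zero {E : Type*} [NormedAddCommGroup E]
    [InnerProductSpace ℝ E] [FiniteDimensional ℝ E] (e : ℕ → E) {k : ℕ}
    (hk : k < Module.finrank ℝ E) : ∃ w : E, w ≠ 0 ∧ ∀ j < k, ⟪w, e j⟫_ℝ = 0 := by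
  classical
  set V := Submodule.span ℝ (Set.range fun i : Fin k => e i) with hV
  have h1 : Module.finrank ℝ V ≤ k := by
    simpa [Set.finrank] using finrank_range_le_card (R := ℝ) (fun i : Fin k => e i)
  have h2 := V.finrank_add_finrank_orthogonal
  have h3 : Vᗮ ≠ ⊥ := by
    intro h
    rw [h, finrank_bot] at h2
    omega
  obtain ⟨w, hw, hw0⟩ := Submodule.exists_mem_ne_zero_of_ne_bot h3
  refine ⟨w, hw0, fun j hj => ?_⟩
  rw [real_inner_comm]
  exact (Submodule.mem_orthogonal _ _).1 hw _ (Submodule.subset_span ⟨⟨j, hj⟩, rfl⟩)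

/-- A symmetric convex body contains the cross-polytope, and lies in a dilate of the box, spanned by
an orthogonal frame of decreasing lengths. -/
theorem exists_inscribed_frame {E : Type*} [NormedAddCommGroup E]
    [InnerProductSpace ℝ E] [FiniteDimensional ℝ E] {Q : Set E} (hc : IsCompact Q)
    (hconv : Convex ℝ Q) (hsym : ∀ x ∈ Q, -x ∈ Q) {ρ : ℝ} (hρ : 0 < ρ)
    (hball : Metric.closedBall 0 ρ ⊆ Q) (k : ℕ) (hk : k ≤ Module.finrank ℝ E) :
    ∃ (e : ℕ → E) (a : ℕ → ℝ),
      (∀ i < k, ∀ j < k, ⟪e i, e j⟫_ℝ = if i = j then 1 else 0) ∧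
      (∀ i < k, 0 < a i ∧ a i • e i ∈ Q) ∧
      (∀ i < k, ∀ x ∈ Q, |⟪x, e i⟫_ℝ| ≤ 2 ^ i * a i) ∧
      (∀ i < k, ∀ x ∈ Q, (∀ j < i, ⟪x, e j⟫_ℝ = 0) → ‖x‖ ≤ a i) ∧
      (∀ x ∈ Q, ((2 : ℝ) ^ k)⁻¹ • (x - ∑ i ∈ Finset.range k, ⟪x, e i⟫_ℝ • e i) ∈ Q) := by
  induction k with
  | zero => exact ⟨0, 0, by simp, by simp, by simp, by simp, by simp⟩
  | succ k ih =>
    obtain ⟨e, a, horth, hmem, hbox, hmax, hproj⟩ := ih (by omega)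
    have h0Q : (0 : E) ∈ Q := hball (by simp [hρ.le])
    set W : Set E := {x | ∀ j < k, ⟪x, e j⟫_ℝ = 0} with hW
    have hWclosed : IsClosed W := by
      simp only [hW, Set.ofPred_forall]
      exact isClosed_iInter fun j => isClosed_iInter fun _ =>
        isClosed_eq (by fun_prop) (by fun_prop)
    obtain ⟨y, ⟨hyQ, hyW⟩, hymax⟩ := (hc.inter_right hWclosed).exists_isMaxOn
      ⟨0, h0Q, by simp [hW]⟩ (continuous_norm.continuousOn)
    obtain ⟨w, hw0, hw⟩ := exists_ne_zero_forall_inner_eq_zero e (k := k) (by omega)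
    have hwn : 0 < ‖w‖ := norm_pos_iff.2 hw0
    have hypos : 0 < ‖y‖ := by
      have h1 : ‖(ρ / ‖w‖) • w‖ = ρ := by
        rw [norm_smul, Real.norm_of_nonneg (by positivity)]
        field_simp
      have h2 : (ρ / ‖w‖) • w ∈ Q ∩ W :=
        ⟨hball (by simp [h1]), fun j hj => by simp [inner_smul_left, hw j hj]⟩
      have := hymax h2
      simp only [Set.mem_ofPred_eq, h1] at this
      linarith
    set f : E := ‖y‖⁻¹ • y with hf
    have hyf : ‖y‖ • f = y := by
      rw [hf, smul_smul, mul_inv_cancel₀ hypos.ne', one_smul]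
    have hff : ⟪f, f⟫_ℝ = 1 := by
      rw [hf, real_inner_smul_left, real_inner_smul_right, real_inner_self_eq_norm_sq]
      field_simp
    have hfe : ∀ j < k, ⟪f, e j⟫_ℝ = 0 := fun j hj => by
      simp [hf, inner_smul_left, hyW j hj]
    have hfn : ‖f‖ = 1 := by
      rw [hf, norm_smul, norm_inv, norm_norm, inv_mul_cancel₀ hypos.ne']
    have hbound : ∀ x ∈ Q, ∀ z, z = ((2 : ℝ) ^ k)⁻¹ • (x - ∑ i ∈ Finset.range k, ⟪x, e i⟫_ℝ • e i) →
        z ∈ Q ∧ |⟪z, f⟫_ℝ| ≤ ‖y‖ ∧ ⟪x, f⟫_ℝ = 2 ^ k * ⟪z, f⟫_ℝ := by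
      intro x hx z hz
      have hzQ : z ∈ Q := hz ▸ hproj x hx
      refine ⟨hzQ, ?_, ?_⟩
      · have hzW : z ∈ W := by
          intro j hj
          rw [hz, real_inner_smul_left, inner_sub_left, sum_inner,
            Finset.sum_eq_single j]
          · rw [real_inner_smul_left, horth j hj j hj]; simp
          · intro i hi hij
            rw [real_inner_smul_left, horth i (Finset.mem_range.1 hi) j hj, if_neg hij, mul_zero]
          · intro h; exact absurd (Finset.mem_range.2 hj) h
        have h1 : ‖z‖ ≤ ‖y‖ := hymax ⟨hzQ, hzW⟩
        have h2 := abs_real_inner_le_norm z f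
        rw [hfn, mul_one] at h2
        exact h2.trans h1
      · rw [hz, real_inner_smul_left, inner_sub_left, sum_inner, Finset.sum_eq_zero]
        · field_simp; ring
        · intro i hi
          rw [real_inner_smul_left, real_inner_comm f, hfe i (Finset.mem_range.1 hi), mul_zero]
    have hlt : ∀ i < k + 1, i ≠ k → i < k := fun i hi hik => by omega
    refine ⟨Function.update e k f, Function.update a k ‖y‖, ?_, ?_, ?_, ?_, ?_⟩
    · intro i hi j hj
      by_cases hik : i = k <;> by_cases hjk : j = k
      · subst hik; subst hjk; simp [hfn]
      · subst hik
        simp [hjk, hfe j (hlt j hj hjk), Ne.symm hjk]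
      · subst hjk
        rw [real_inner_comm]
        simp [hik, hfe i (hlt i hi hik)]
      · simp [hik, hjk, horth i (hlt i hi hik) j (hlt j hj hjk)]
    · intro i hi
      by_cases hik : i = k
      · subst hik; simp [hyf, hyQ, norm_pos_iff.1 hypos]
      · simpa [hik] using hmem i (hlt i hi hik)
    · intro i hi x hx
      by_cases hik : i = k
      · subst hik
        obtain ⟨-, h1, h2⟩ := hbound x hx _ rfl
        simp only [Function.update_self]
        rw [h2, abs_mul, abs_of_pos (by positivity)]
        gcongr
      · simpa [hik] using hbox i (hlt i hi hik) x hx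
    · intro i hi x hx hxo
      by_cases hik : i = k
      · subst hik
        simp only [Function.update_self]
        refine hymax ⟨hx, fun j hj => ?_⟩
        simpa [hj.ne] using hxo j hj
      · have hi' := hlt i hi hik
        simp only [Function.update_of_ne hik]
        refine hmax i hi' x hx fun j hj => ?_
        simpa [(hj.trans hi').ne] using hxo j hj
    · intro x hx
      obtain ⟨hzQ, h1, h2⟩ := hbound x hx _ rfl
      set z := ((2 : ℝ) ^ k)⁻¹ • (x - ∑ i ∈ Finset.range k, ⟪x, e i⟫_ℝ • e i) with hz
      have hsum : ∑ i ∈ Finset.range (k + 1), ⟪x, Function.update e k f i⟫_ℝ • Function.update e k f i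
          = ∑ i ∈ Finset.range k, ⟪x, e i⟫_ℝ • e i + ⟪x, f⟫_ℝ • f := by
        rw [Finset.sum_range_succ, Function.update_self]
        congr 1
        refine Finset.sum_congr rfl fun i hi => ?_
        rw [Function.update_of_ne (Finset.mem_range.1 hi).ne]
      have hfQ : -(⟪z, f⟫_ℝ • f) ∈ Q := by
        have h3 : -(⟪z, f⟫_ℝ • f) = (-(⟪z, f⟫_ℝ / ‖y‖)) • y := by
          rw [neg_smul, hf, smul_smul, div_eq_mul_inv]
        rw [h3]
        have h4 : |⟪z, f⟫_ℝ / ‖y‖| ≤ 1 := by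
          rw [abs_div, abs_norm]; exact div_le_one_of_le₀ h1 hypos.le
        obtain ⟨h5, h6⟩ := abs_le.1 h4
        set t := ⟪z, f⟫_ℝ / ‖y‖
        have := hconv hyQ (hsym y hyQ) (a := (1 - t) / 2) (b := (1 + t) / 2)
          (by linarith) (by linarith) (by ring)
        convert this using 1
        module
      have := hconv hzQ hfQ (a := 1 / 2) (b := 1 / 2) (by norm_num) (by norm_num) (by norm_num)
      convert this using 1
      rw [hsum, h2, show ((2 : ℝ) ^ (k + 1))⁻¹ = 2⁻¹ * (2 ^ k)⁻¹ by rw [pow_succ, mul_inv, mul_comm],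
        mul_smul, ← sub_sub, smul_sub ((2 ^ k)⁻¹ : ℝ), ← hz, smul_smul,
        inv_mul_cancel_left₀ (pow_ne_zero k two_ne_zero)]
      module

theorem exists_orthonormalBasis_coe_eq {n : ℕ} {e : Fin n → EuclideanSpace ℝ (Fin n)}
    (he : Orthonormal ℝ e) :
    ∃ b : OrthonormalBasis (Fin n) ℝ (EuclideanSpace ℝ (Fin n)), ⇑b = e := by
  have hspan := he.linearIndependent.span_eq_top_of_card_eq_finrank' (by simp)
  exact ⟨OrthonormalBasis.mk he hspan.ge, OrthonormalBasis.coe_mk he hspan.ge⟩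

theorem volume_toReal_le_of_forall_abs_inner_le {n : ℕ} {e : Fin n → EuclideanSpace ℝ (Fin n)}
    (he : Orthonormal ℝ e) {Q : Set (EuclideanSpace ℝ (Fin n))} {c : Fin n → ℝ}
    (hc : ∀ i, 0 ≤ c i) (hQ : ∀ x ∈ Q, ∀ i, |⟪x, e i⟫_ℝ| ≤ c i) :
    (volume Q).toReal ≤ ∏ i, (2 * c i) := by
  obtain ⟨b, rfl⟩ := exists_orthonormalBasis_coe_eq he
  have hmp := (PiLp.volume_preserving_ofLp (Fin n)).comp b.measurePreserving_repr
  have hsub : Q ⊆ (WithLp.ofLp ∘ b.repr) ⁻¹' Set.Icc (-c) c := by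
    intro x hx
    refine ⟨fun i => ?_, fun i => ?_⟩ <;>
    · have := abs_le.1 (hQ x hx i)
      rw [real_inner_comm, ← b.repr_apply_apply] at this
      simp [this]
  have hvol : volume ((WithLp.ofLp ∘ b.repr) ⁻¹' Set.Icc (-c) c) = volume (Set.Icc (-c) c) :=
    hmp.measure_preimage measurableSet_Icc.nullMeasurableSet
  have hle : -c ≤ c := fun i => by simpa using (hc i)
  calc (volume Q).toReal ≤ (volume (Set.Icc (-c) c)).toReal := by
        refine ENNReal.toReal_mono ?_ ((measure_mono hsub).trans hvol.le)
        exact isCompact_Icc.measure_lt_top.ne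
    _ = ∏ i, (2 * c i) := by
        rw [Real.volume_Icc_pi_toReal hle]
        exact Finset.prod_congr rfl fun i _ => by simp; ring

theorem closedBall_subset_of_orthonormal {n : ℕ} (hn : 0 < n)
    {e : Fin n → EuclideanSpace ℝ (Fin n)}
    (he : Orthonormal ℝ e) {Q : Set (EuclideanSpace ℝ (Fin n))} (hconv : Convex ℝ Q)
    (hsym : ∀ x ∈ Q, -x ∈ Q) {a : Fin n → ℝ} (hmem : ∀ i, a i • e i ∈ Q)
    {r : ℝ} (hr : ∀ i, n * r ≤ a i) (ha : ∀ i, 0 < a i) : Metric.closedBall 0 r ⊆ Q := by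
  obtain ⟨b, rfl⟩ := exists_orthonormalBasis_coe_eq he
  intro x hx
  have hn' : (0 : ℝ) < n := by exact_mod_cast hn
  have hxn : ‖x‖ ≤ r := by simpa using hx
  have hpt : ∀ i, (n * ⟪b i, x⟫_ℝ) • b i ∈ Q := by
    intro i
    have h1 : |⟪b i, x⟫_ℝ| ≤ r := by
      have := abs_real_inner_le_norm (b i) x
      rw [b.norm_eq_one, one_mul] at this
      exact this.trans hxn
    have h2 : |n * ⟪b i, x⟫_ℝ / a i| ≤ 1 := by
      rw [abs_div, abs_mul, abs_of_pos hn', abs_of_pos (ha i), div_le_one (ha i)]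
      exact (mul_le_mul_of_nonneg_left h1 hn'.le).trans (hr i)
    obtain ⟨h5, h6⟩ := abs_le.1 h2
    have h3 : (n * ⟪b i, x⟫_ℝ) • b i = (n * ⟪b i, x⟫_ℝ / a i) • a i • b i := by
      rw [smul_smul, div_mul_cancel₀ _ (ha i).ne']
    rw [h3]
    set t := n * ⟪b i, x⟫_ℝ / a i
    have := hconv (hmem i) (hsym _ (hmem i)) (a := (1 + t) / 2) (b := (1 - t) / 2)
      (by linarith) (by linarith) (by ring)
    convert this using 1
    module
  have := hconv.sum_mem (t := Finset.univ) (w := fun _ : Fin n => (n : ℝ)⁻¹)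
    (fun i _ => by positivity) (by simp [hn'.ne']) (fun i _ => hpt i)
  convert this using 1
  conv_lhs => rw [← b.sum_repr' x]
  refine Finset.sum_congr rfl fun i _ => ?_
  rw [smul_smul, inv_mul_cancel_left₀ hn'.ne']

theorem sum_range_mul_sub (L : ℕ → ℝ) (m : ℕ) :
    ∑ k ∈ Finset.range m, ((m : ℝ) - k) * (L k - L (k + 1))
      = (m + 1) * L 0 - ∑ k ∈ Finset.range (m + 1), L k := by
  induction m with
  | zero => simp
  | succ m ih =>
    have h : ∀ k ∈ Finset.range (m + 1), (((m + 1 : ℕ) : ℝ) - k) * (L k - L (k + 1))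
        = ((m : ℝ) - k) * (L k - L (k + 1)) + (L k - L (k + 1)) := fun k _ => by
      push_cast; ring
    rw [Finset.sum_congr rfl h, Finset.sum_add_distrib, Finset.sum_range_sub',
      Finset.sum_range_succ, ih, Finset.sum_range_succ _ (m + 1)]
    push_cast
    ring

/-- The unit vectors whose first `k` coordinates in the frame `e` are smaller than `ε`. -/
def frameSlab {n : ℕ} (e : Fin n → EuclideanSpace ℝ (Fin n)) (k : ℕ) (ε : ℝ) :
    Set (EuclideanSpace ℝ (Fin n)) :=
  {u | u ∈ unitSphere n ∧ ∀ i : Fin n, i.val < k → |⟪u, e i⟫_ℝ| < ε}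

theorem measurableSet_frameSlab {n : ℕ} (e : Fin n → EuclideanSpace ℝ (Fin n)) (k : ℕ) (ε : ℝ) :
    MeasurableSet (frameSlab e k ε) := by
  refine MeasurableSet.inter Metric.isClosed_sphere.measurableSet ?_
  have : IsOpen {u : EuclideanSpace ℝ (Fin n) | ∀ i : Fin n, i.val < k → |⟪u, e i⟫_ℝ| < ε} := by
    simp only [Set.ofPred_forall]
    exact isOpen_iInter_of_finite fun i => isOpen_iInter_of_finite fun _ =>
      isOpen_lt (by fun_prop) (by fun_prop)
  exact this.measurableSet

theorem frameSlab_mono {n : ℕ} (e : Fin n → EuclideanSpace ℝ (Fin n)) (k : ℕ) {ε ε' : ℝ}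
    (h : ε ≤ ε') : frameSlab e k ε ⊆ frameSlab e k ε' :=
  fun _ hu => ⟨hu.1, fun i hi => (hu.2 i hi).trans_le h⟩

theorem frameSlab_subset_of_dist_le {n : ℕ} {e e' : Fin n → EuclideanSpace ℝ (Fin n)} {k : ℕ}
    {ε : ℝ} (h : dist e' e < ε / 2) : frameSlab e' k (ε / 2) ⊆ frameSlab e k ε := by
  refine fun u hu => ⟨hu.1, fun i hi => ?_⟩
  have h1 : ⟪u, e i⟫_ℝ = ⟪u, e' i⟫_ℝ - ⟪u, e' i - e i⟫_ℝ := by rw [inner_sub_right]; ring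
  have h2 := abs_real_inner_le_norm u (e' i - e i)
  have h3 : ‖u‖ = 1 := by simpa [unitSphere] using hu.1
  have h4 : ‖e' i - e i‖ < ε / 2 := by
    rw [← dist_eq_norm]; exact (dist_le_pi_dist e' e i).trans_lt h
  rw [h3, one_mul] at h2
  have h5 := abs_sub (⟪u, e' i⟫_ℝ) (⟪u, e' i - e i⟫_ℝ)
  have h6 := hu.2 i hi
  rw [h1]
  linarith

theorem measure_subspace_real_lt {n : ℕ} (ν : Measure (EuclideanSpace ℝ (Fin n)))
    [IsFiniteMeasure ν]
    (hνscc : ∀ H : Submodule ℝ (EuclideanSpace ℝ (Fin n)),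
      0 < Module.finrank ℝ H → Module.finrank ℝ H < n →
      ν ((H : Set (EuclideanSpace ℝ (Fin n))) ∩ unitSphere n)
        < ((Module.finrank ℝ H : ℝ≥0∞) / (n : ℝ≥0∞)) * ν (unitSphere n))
    {e : Fin n → EuclideanSpace ℝ (Fin n)} (he : Orthonormal ℝ e) {k : ℕ} (hk0 : 0 < k)
    (hkn : k < n) :
    ν.real {u | u ∈ unitSphere n ∧ ∀ i : Fin n, i.val < k → ⟪u, e i⟫_ℝ = 0}
      < ((n : ℝ) - k) / n * ν.real (unitSphere n) := by
  set f : Fin k → EuclideanSpace ℝ (Fin n) := fun i => e (Fin.castLE hkn.le i) with hf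
  have hfo : Orthonormal ℝ f := he.comp _ (Fin.castLE_injective hkn.le)
  set V := Submodule.span ℝ (Set.range f) with hV
  have h1 : Module.finrank ℝ V = k := by
    simpa using finrank_span_eq_card hfo.linearIndependent
  have h2 := V.finrank_add_finrank_orthogonal
  rw [finrank_euclideanSpace_fin] at h2
  have h3 : Module.finrank ℝ Vᗮ = n - k := by omega
  have h4 := hνscc Vᗮ (by omega) (by omega)
  have hset : {u | u ∈ unitSphere n ∧ ∀ i : Fin n, i.val < k → ⟪u, e i⟫_ℝ = 0}
      = ((Vᗮ : Submodule ℝ (EuclideanSpace ℝ (Fin n))) : Set (EuclideanSpace ℝ (Fin n)))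
        ∩ unitSphere n := by
    ext u
    rw [Set.inter_comm]
    refine and_congr Iff.rfl ?_
    rw [SetLike.mem_coe, Submodule.mem_orthogonal']
    constructor
    · intro h v hv
      induction hv using Submodule.span_induction with
      | mem x hx =>
        obtain ⟨i, rfl⟩ := hx
        exact h _ i.2
      | zero => exact inner_zero_right u
      | add x y _ _ hx hy => rw [inner_add_right, hx, hy, add_zero]
      | smul c x _ hx => rw [real_inner_smul_right, hx, mul_zero]
    · intro h i hi
      exact h _ (Submodule.subset_span ⟨⟨i, hi⟩, rfl⟩)
  rw [hset, Measure.real, Measure.real]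
  have h5 := (ENNReal.toReal_lt_toReal (measure_ne_top _ _) (by
    refine ENNReal.mul_ne_top (ENNReal.div_ne_top (by simp) ?_) (measure_ne_top _ _)
    exact_mod_cast (by omega : n ≠ 0))).2 h4
  refine h5.trans_eq ?_
  rw [ENNReal.toReal_mul, ENNReal.toReal_div, h3]
  rw [ENNReal.toReal_natCast, ENNReal.toReal_natCast, Nat.cast_sub hkn.le]

theorem isCompact_setOf_orthonormal (n : ℕ) :
    IsCompact {e : Fin n → EuclideanSpace ℝ (Fin n) | Orthonormal ℝ e} := by
  have hK : IsCompact (Set.univ.pi fun _ : Fin n =>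
      Metric.sphere (0 : EuclideanSpace ℝ (Fin n)) 1) :=
    isCompact_univ_pi fun _ => isCompact_sphere 0 1
  refine hK.of_isClosed_subset ?_ fun e he i _ => by simpa using he.1 i
  simp only [orthonormal_iff_ite, Set.ofPred_forall]
  refine isClosed_iInter fun i => isClosed_iInter fun j => isClosed_eq ?_ (by fun_prop)
  exact (continuous_apply i).inner (continuous_apply j)

theorem exists_frameSlab_real_le {n : ℕ} (ν : Measure (EuclideanSpace ℝ (Fin n)))
    [IsFiniteMeasure ν]
    (hνscc : ∀ H : Submodule ℝ (EuclideanSpace ℝ (Fin n)),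
      0 < Module.finrank ℝ H → Module.finrank ℝ H < n →
      ν ((H : Set (EuclideanSpace ℝ (Fin n))) ∩ unitSphere n)
        < ((Module.finrank ℝ H : ℝ≥0∞) / (n : ℝ≥0∞)) * ν (unitSphere n))
    {e : Fin n → EuclideanSpace ℝ (Fin n)} (he : Orthonormal ℝ e) :
    ∃ ε > 0, ∀ k, 0 < k → k < n →
      ν.real (frameSlab e k ε) ≤ ((n : ℝ) - k) / n * ν.real (unitSphere n) - ε := by
  have key : ∀ k, 0 < k → k < n → ∀ᶠ m : ℕ in atTop,
      ν.real (frameSlab e k (1 / ((m : ℝ) + 1))) + 1 / ((m : ℝ) + 1)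
        < ((n : ℝ) - k) / n * ν.real (unitSphere n) := by
    intro k hk0 hkn
    have hinter : ⋂ m : ℕ, frameSlab e k (1 / ((m : ℝ) + 1))
        = {u | u ∈ unitSphere n ∧ ∀ i : Fin n, i.val < k → ⟪u, e i⟫_ℝ = 0} := by
      ext u
      simp only [Set.mem_iInter, frameSlab, Set.mem_ofPred_eq]
      constructor
      · intro h
        refine ⟨(h 0).1, fun i hi => abs_nonpos_iff.1 ?_⟩
        exact ge_of_tendsto tendsto_one_div_add_atTop_nhds_zero_nat
          (Eventually.of_forall fun m => ((h m).2 i hi).le)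
      · intro h m
        refine ⟨h.1, fun i hi => ?_⟩
        rw [h.2 i hi, abs_zero]
        positivity
    have h1 := tendsto_measure_iInter_atTop (μ := ν)
      (s := fun m : ℕ => frameSlab e k (1 / ((m : ℝ) + 1)))
      (fun m => (measurableSet_frameSlab e k _).nullMeasurableSet)
      (fun m m' h => frameSlab_mono e k (Nat.one_div_le_one_div h)) ⟨0, measure_ne_top _ _⟩
    have h2 := (ENNReal.tendsto_toReal (measure_ne_top ν _)).comp h1
    have h3 := h2.add (tendsto_one_div_add_atTop_nhds_zero_nat (𝕜 := ℝ))
    rw [hinter, add_zero] at h3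
    exact h3.eventually_lt_const (measure_subspace_real_lt ν hνscc he hk0 hkn)
  have hall : ∀ᶠ m : ℕ in atTop, ∀ k ∈ Finset.range n, 0 < k →
      ν.real (frameSlab e k (1 / ((m : ℝ) + 1))) + 1 / ((m : ℝ) + 1)
        < ((n : ℝ) - k) / n * ν.real (unitSphere n) := by
    rw [Filter.eventually_all_finset]
    intro k hk
    by_cases hk0 : 0 < k
    · filter_upwards [key k hk0 (Finset.mem_range.1 hk)] with m hm _ using hm
    · exact Eventually.of_forall fun m h => absurd h hk0
  obtain ⟨m, hm⟩ := hall.exists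
  refine ⟨1 / ((m : ℝ) + 1), by positivity, fun k hk0 hkn => ?_⟩
  have := hm k (Finset.mem_range.2 hkn) hk0
  linarith

/-- The strict subspace concentration inequality holds with a uniform margin near all subspaces. -/
theorem exists_uniform_frameSlab_real_le {n : ℕ} (ν : Measure (EuclideanSpace ℝ (Fin n)))
    [IsFiniteMeasure ν]
    (hνscc : ∀ H : Submodule ℝ (EuclideanSpace ℝ (Fin n)),
      0 < Module.finrank ℝ H → Module.finrank ℝ H < n →
      ν ((H : Set (EuclideanSpace ℝ (Fin n))) ∩ unitSphere n)
        < ((Module.finrank ℝ H : ℝ≥0∞) / (n : ℝ≥0∞)) * ν (unitSphere n)) :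
    ∃ ε > 0, ∀ e : Fin n → EuclideanSpace ℝ (Fin n), Orthonormal ℝ e → ∀ k, 0 < k → k < n →
      ν.real (frameSlab e k ε) ≤ ((n : ℝ) - k) / n * ν.real (unitSphere n) - ε := by
  have shrink : ∀ {ε ε' : ℝ} {e : Fin n → EuclideanSpace ℝ (Fin n)} {k : ℕ}, ε' ≤ ε →
      ν.real (frameSlab e k ε) ≤ ((n : ℝ) - k) / n * ν.real (unitSphere n) - ε →
      ν.real (frameSlab e k ε') ≤ ((n : ℝ) - k) / n * ν.real (unitSphere n) - ε' := by
    intro ε ε' e k h h1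
    have := measureReal_mono (μ := ν) (frameSlab_mono e k h)
    linarith
  have := (isCompact_setOf_orthonormal n).induction_on
    (p := fun s => ∃ ε > 0, ∀ e ∈ s, ∀ k, 0 < k → k < n →
      ν.real (frameSlab e k ε) ≤ ((n : ℝ) - k) / n * ν.real (unitSphere n) - ε)
    ⟨1, one_pos, by simp⟩
    (fun s t hst ⟨ε, hε, h⟩ => ⟨ε, hε, fun e he => h e (hst he)⟩)
    (fun s t ⟨ε, hε, h⟩ ⟨ε', hε', h'⟩ => ⟨min ε ε', lt_min hε hε', fun e he k hk0 hkn =>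
      he.elim (fun he => shrink (min_le_left _ _) (h e he k hk0 hkn))
        (fun he => shrink (min_le_right _ _) (h' e he k hk0 hkn))⟩)
    (fun e he => by
      obtain ⟨ε, hε, h⟩ := exists_frameSlab_real_le ν hνscc he
      refine ⟨Metric.ball e (ε / 2),
        mem_nhdsWithin_of_mem_nhds (Metric.ball_mem_nhds e (half_pos hε)), ε / 2, half_pos hε,
        fun e' he' k hk0 hkn => ?_⟩
      have h1 := measureReal_mono (μ := ν) (frameSlab_subset_of_dist_le (k := k) he')
      have h2 := h k hk0 hkn
      linarith)
  exact this

theorem inner_le_suppFn {n : ℕ} {K : Set (EuclideanSpace ℝ (Fin n))} (hK : IsCompact K)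
    {y : EuclideanSpace ℝ (Fin n)} (hy : y ∈ K) (u : EuclideanSpace ℝ (Fin n)) :
    ⟪y, u⟫_ℝ ≤ suppFn K u :=
  le_csSup (hK.image (by fun_prop)).bddAbove ⟨y, hy, rfl⟩

theorem continuous_suppFn {n : ℕ} {K : Set (EuclideanSpace ℝ (Fin n))} (hK : IsCompact K) :
    Continuous (suppFn K) :=
  hK.continuous_sSup (f := fun u y => ⟪y, u⟫_ℝ) (by fun_prop)

theorem le_suppFn_of_closedBall_subset {n : ℕ} {K : Set (EuclideanSpace ℝ (Fin n))}
    (hK : IsCompact K) {r : ℝ} (hr : 0 ≤ r) (hball : Metric.closedBall 0 r ⊆ K)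
    {u : EuclideanSpace ℝ (Fin n)} (hu : u ∈ unitSphere n) : r ≤ suppFn K u := by
  have hu1 : ‖u‖ = 1 := by simpa [unitSphere] using hu
  have h1 : r • u ∈ K := hball (by simp [norm_smul, hu1, abs_of_nonneg hr])
  have h2 := inner_le_suppFn hK h1 u
  rwa [real_inner_smul_left, real_inner_self_eq_norm_sq, hu1, one_pow, mul_one] at h2

theorem IsConvexBody.exists_closedBall_subset {n : ℕ} {K : Set (EuclideanSpace ℝ (Fin n))}
    (hK : IsConvexBody K) (hsym : K = -K) : ∃ r > 0, Metric.closedBall 0 r ⊆ K := by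
  obtain ⟨x, hx⟩ := hK.2.2
  have hx' : -x ∈ interior K := by
    have h1 := (Homeomorph.neg (EuclideanSpace ℝ (Fin n))).preimage_interior K
    have h2 : -x ∈ (Homeomorph.neg (EuclideanSpace ℝ (Fin n))) ⁻¹' interior K := by simpa using hx
    rw [h1] at h2
    rw [hsym]
    exact h2
  have h0 : (0 : EuclideanSpace ℝ (Fin n)) ∈ interior K := by
    have := hK.2.1.interior hx hx' (a := 1 / 2) (b := 1 / 2) (by norm_num) (by norm_num)
      (by norm_num)
    simpa using this
  exact Metric.nhds_basis_closedBall.mem_iff.1 (mem_interior_iff_mem_nhds.1 h0)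

theorem integrable_log_suppFn {n : ℕ} {ν : Measure (EuclideanSpace ℝ (Fin n))}
    [IsFiniteMeasure ν] (hνsupp : ν (unitSphere n)ᶜ = 0)
    {K : Set (EuclideanSpace ℝ (Fin n))} (hK : IsCompact K) {r : ℝ} (hr : 0 < r)
    (hball : Metric.closedBall 0 r ⊆ K) : Integrable (fun u => Real.log (suppFn K u)) ν := by
  have h1 : ContinuousOn (fun u => Real.log (suppFn K u)) (unitSphere n) :=
    (continuous_suppFn hK).continuousOn.log fun u hu =>
      (hr.trans_le (le_suppFn_of_closedBall_subset hK hr.le hball hu)).ne'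
  have h2 := h1.integrableOn_compact (μ := ν) (isCompact_sphere 0 1)
  rwa [IntegrableOn, Measure.restrict_eq_self_of_ae_mem] at h2
  exact hνsupp

theorem exists_le_abs_inner {n : ℕ} {e : Fin n → EuclideanSpace ℝ (Fin n)}
    (he : Orthonormal ℝ e) {ε : ℝ} (hε : ε * n ≤ 1) (hn : 2 ≤ n)
    {u : EuclideanSpace ℝ (Fin n)} (hu : u ∈ unitSphere n) : ∃ i, ε ≤ |⟪u, e i⟫_ℝ| := by
  obtain ⟨b, rfl⟩ := exists_orthonormalBasis_coe_eq he
  by_contra! h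
  have hu1 : ‖u‖ = 1 := by simpa [unitSphere] using hu
  have hn' : (2 : ℝ) ≤ n := by exact_mod_cast hn
  have hε0 : 0 ≤ ε := (abs_nonneg _).trans (h ⟨0, by omega⟩).le
  have h1 := b.sum_sq_norm_inner_right u
  have h2 : ∑ i, ‖⟪b i, u⟫_ℝ‖ ^ 2 ≤ ∑ _i : Fin n, ε ^ 2 := by
    refine Finset.sum_le_sum fun i _ => ?_
    rw [Real.norm_eq_abs, real_inner_comm]
    exact pow_le_pow_left₀ (abs_nonneg _) (h i).le 2
  rw [h1, hu1] at h2
  simp at h2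
  nlinarith

theorem le_log_suppFn {n : ℕ} (hn : 2 ≤ n) {K : Set (EuclideanSpace ℝ (Fin n))}
    (hK : IsCompact K) (hsym : ∀ x ∈ K, -x ∈ K) {e : ℕ → EuclideanSpace ℝ (Fin n)}
    (he : Orthonormal ℝ fun i : Fin n => e i) {a : ℕ → ℝ} (ha : ∀ i < n, 0 < a i)
    (hmem : ∀ i < n, a i • e i ∈ K) (hanti : ∀ i j, i ≤ j → j < n → a j ≤ a i)
    {ε : ℝ} (hε0 : 0 < ε) (hε : ε * n ≤ 1) {u : EuclideanSpace ℝ (Fin n)}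
    (hu : u ∈ unitSphere n) :
    Real.log ε + (Real.log (a 0) - ∑ k ∈ Finset.range (n - 1),
      (frameSlab (fun i : Fin n => e i) (k + 1) ε).indicator 1 u
        * (Real.log (a k) - Real.log (a (k + 1)))) ≤ Real.log (suppFn K u) := by
  classical
  have hex : ∃ j, j < n ∧ ε ≤ |⟪u, e j⟫_ℝ| := by
    obtain ⟨i, hi⟩ := exists_le_abs_inner he hε hn hu
    exact ⟨i, i.2, hi⟩
  obtain ⟨hjn, hj⟩ := Nat.find_spec hex
  have hmin : ∀ i, i < Nat.find hex → |⟪u, e i⟫_ℝ| < ε := fun i hi =>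
    not_le.1 fun h => Nat.find_min hex hi ⟨hi.trans hjn, h⟩
  set j := Nat.find hex
  have hsum : Real.log (a 0) - Real.log (a j) ≤ ∑ k ∈ Finset.range (n - 1),
      (frameSlab (fun i : Fin n => e i) (k + 1) ε).indicator 1 u
        * (Real.log (a k) - Real.log (a (k + 1))) := by
    rw [← Finset.sum_range_sub' (fun k => Real.log (a k))]
    calc ∑ k ∈ Finset.range j, (Real.log (a k) - Real.log (a (k + 1)))
        = ∑ k ∈ Finset.range j, (frameSlab (fun i : Fin n => e i) (k + 1) ε).indicator 1 u
          * (Real.log (a k) - Real.log (a (k + 1))) := by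
          refine Finset.sum_congr rfl fun k hk => ?_
          rw [Set.indicator_of_mem, Pi.one_apply, one_mul]
          exact ⟨hu, fun i hi => hmin i (by have := Finset.mem_range.1 hk; omega)⟩
      _ ≤ _ := by
          refine Finset.sum_le_sum_of_subset_of_nonneg
            (Finset.range_subset_range.2 (by omega)) fun k hk _ => mul_nonneg ?_ ?_
          · exact Set.indicator_nonneg (fun _ _ => zero_le_one) _
          · have := Finset.mem_range.1 hk
            exact sub_nonneg.2 (Real.log_le_log (ha _ (by omega))
              (hanti _ _ (Nat.le_succ k) (by omega)))
  have hsupp : ε * a j ≤ suppFn K u := by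
    have h1 := inner_le_suppFn hK (hmem j hjn) u
    have h2 := inner_le_suppFn hK (hsym _ (hmem j hjn)) u
    rw [inner_neg_left] at h2
    rw [real_inner_smul_left, real_inner_comm] at h1 h2
    calc ε * a j ≤ |⟪u, e j⟫_ℝ| * a j := mul_le_mul_of_nonneg_right hj (ha j hjn).le
      _ = |a j * ⟪u, e j⟫_ℝ| := by rw [abs_mul, abs_of_pos (ha j hjn), mul_comm]
      _ ≤ suppFn K u := abs_le'.2 ⟨h1, h2⟩
  have hlog := Real.log_le_log (mul_pos hε0 (ha j hjn)) hsupp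
  rw [Real.log_mul hε0.ne' (ha j hjn).ne'] at hlog
  linarith

theorem le_logFunc_of_frame {n : ℕ} (hn : 2 ≤ n) {ν : Measure (EuclideanSpace ℝ (Fin n))}
    [IsFiniteMeasure ν] (hνsupp : ν (unitSphere n)ᶜ = 0)
    {K : Set (EuclideanSpace ℝ (Fin n))}
    (hK : IsCompact K) (hsym : ∀ x ∈ K, -x ∈ K) {r : ℝ} (hr : 0 < r)
    (hball : Metric.closedBall 0 r ⊆ K) {e : ℕ → EuclideanSpace ℝ (Fin n)}
    (he : Orthonormal ℝ fun i : Fin n => e i) {a : ℕ → ℝ} (ha : ∀ i < n, 0 < a i)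
    (hmem : ∀ i < n, a i • e i ∈ K) (hanti : ∀ i j, i ≤ j → j < n → a j ≤ a i)
    {ε : ℝ} (hε0 : 0 < ε) (hε : ε * n ≤ 1)
    (hslab : ∀ k, 0 < k → k < n → ν.real (frameSlab (fun i : Fin n => e i) k ε)
      ≤ ((n : ℝ) - k) / n * ν.real (unitSphere n) - ε) :
    ν.real (unitSphere n) * Real.log ε
      + ν.real (unitSphere n) / n * ∑ k ∈ Finset.range n, Real.log (a k)
      + ε * (Real.log (a 0) - Real.log (a (n - 1))) ≤ logFunc ν K := by
  obtain ⟨m, rfl⟩ : ∃ m, n = m + 1 := ⟨n - 1, by omega⟩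
  simp only [Nat.add_sub_cancel]
  set L : ℕ → ℝ := fun k => Real.log (a k) with hL
  set μ := ν.real (unitSphere (m + 1)) with hμ
  have huniv : ν.real Set.univ = μ := by
    rw [hμ, Measure.real, Measure.real, ← measure_add_measure_compl (s := unitSphere (m + 1))
      Metric.isClosed_sphere.measurableSet, hνsupp, add_zero]
  set N : ℕ → Set (EuclideanSpace ℝ (Fin (m + 1))) := fun k => frameSlab (fun i => e i) k ε
  have hNm : ∀ k, MeasurableSet (N k) := fun k => measurableSet_frameSlab _ k ε
  have hint : ∀ k ∈ Finset.range m, Integrable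
      (fun u => (N (k + 1)).indicator (1 : EuclideanSpace ℝ (Fin (m + 1)) → ℝ) u * (L k - L (k + 1))) ν := fun k _ =>
    ((integrable_const (1 : ℝ)).indicator (hNm _)).mul_const _
  have hints := integrable_finsetSum _ hint
  have hsub : Integrable (fun u => L 0 - ∑ k ∈ Finset.range m,
      (N (k + 1)).indicator (1 : EuclideanSpace ℝ (Fin (m + 1)) → ℝ) u * (L k - L (k + 1))) ν :=
    (integrable_const _).sub hints
  have hmono : ∫ u, (Real.log ε + (L 0 - ∑ k ∈ Finset.range m,
      (N (k + 1)).indicator (1 : EuclideanSpace ℝ (Fin (m + 1)) → ℝ) u * (L k - L (k + 1)))) ∂ν ≤ logFunc ν K := by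
    refine integral_mono_ae ((integrable_const _).add hsub)
      (integrable_log_suppFn hνsupp hK hr hball) ?_
    have hae : ∀ᵐ u ∂ν, u ∈ unitSphere (m + 1) := hνsupp
    filter_upwards [hae] with u hu
    exact le_log_suppFn hn hK hsym he ha hmem hanti hε0 hε hu
  rw [integral_add (integrable_const _) hsub,
    integral_sub (integrable_const _) hints, integral_finsetSum _ hint] at hmono
  simp only [integral_const, huniv, smul_eq_mul, integral_mul_const,
    integral_indicator_one (hNm _)] at hmono
  have hle : ∑ k ∈ Finset.range m, ν.real (N (k + 1)) * (L k - L (k + 1))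
      ≤ ∑ k ∈ Finset.range m, (μ / (m + 1) * (((m : ℝ) - k) * (L k - L (k + 1)))
        - ε * (L k - L (k + 1))) := by
    refine Finset.sum_le_sum fun k hk => ?_
    have hk' := Finset.mem_range.1 hk
    have h1 : 0 ≤ L k - L (k + 1) := sub_nonneg.2
      (Real.log_le_log (ha _ (by omega)) (hanti _ _ (Nat.le_succ k) (by omega)))
    refine (mul_le_mul_of_nonneg_right (hslab (k + 1) k.succ_pos (by omega)) h1).trans_eq ?_
    push_cast
    ring
  rw [Finset.sum_sub_distrib, ← Finset.mul_sum, ← Finset.mul_sum, sum_range_mul_sub,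
    Finset.sum_range_sub'] at hle
  have hid : μ / (m + 1) * (((m : ℝ) + 1) * L 0 - ∑ k ∈ Finset.range (m + 1), L k)
      = μ * L 0 - μ / (m + 1) * ∑ k ∈ Finset.range (m + 1), L k := by
    field_simp
  rw [hid] at hle
  push_cast
  linarith

/-- Symmetric convex bodies with volume bounded below and log-functional bounded above are
uniformly bounded and uniformly fat. -/
theorem exists_closedBall_subset_subset_closedBall {n : ℕ} (hn : 2 ≤ n)
    {ν : Measure (EuclideanSpace ℝ (Fin n))}
    [IsFiniteMeasure ν] (hνsupp : ν (unitSphere n)ᶜ = 0) (hνpos : 0 < ν (unitSphere n))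
    (hνscc : ∀ H : Submodule ℝ (EuclideanSpace ℝ (Fin n)),
      0 < Module.finrank ℝ H → Module.finrank ℝ H < n →
      ν ((H : Set (EuclideanSpace ℝ (Fin n))) ∩ unitSphere n)
        < ((Module.finrank ℝ H : ℝ≥0∞) / (n : ℝ≥0∞)) * ν (unitSphere n))
    {v : ℝ} (hv : 0 < v) (M : ℝ) :
    ∃ r > 0, ∃ R, ∀ Q : Set (EuclideanSpace ℝ (Fin n)), IsConvexBody Q → Q = -Q →
      v ≤ (volume Q).toReal → logFunc ν Q ≤ M →
      Metric.closedBall 0 r ⊆ Q ∧ Q ⊆ Metric.closedBall 0 R := by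
  have hn0 : (0 : ℝ) < n := by exact_mod_cast (by omega : 0 < n)
  set μ := ν.real (unitSphere n) with hμ
  have hμpos : 0 < μ := ENNReal.toReal_pos hνpos.ne' (measure_ne_top _ _)
  obtain ⟨ε₀, hε₀, hslab₀⟩ := exists_uniform_frameSlab_real_le ν hνscc
  set ε := min ε₀ (min (1 / n) μ) with hεdef
  have hε0 : 0 < ε := lt_min hε₀ (lt_min (by positivity) hμpos)
  have hεn : ε * n ≤ 1 := by
    rw [← le_div_iff₀ hn0]
    exact (min_le_right _ _).trans (min_le_left _ _)
  have hεμ : ε ≤ μ := (min_le_right _ _).trans (min_le_right _ _)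
  have hslab : ∀ e : Fin n → EuclideanSpace ℝ (Fin n), Orthonormal ℝ e → ∀ k, 0 < k → k < n →
      ν.real (frameSlab e k ε) ≤ ((n : ℝ) - k) / n * μ - ε := fun e he k hk0 hkn => by
    have h1 := measureReal_mono (μ := ν) (frameSlab_mono e k (min_le_left ε₀ (min (1 / n) μ)))
    have h2 := hslab₀ e he k hk0 hkn
    have h3 := min_le_left ε₀ (min (1 / n) μ)
    linarith
  set P : ℝ := ∏ i ∈ Finset.range n, (2 * 2 ^ i : ℝ) with hP
  have hPpos : 0 < P := Finset.prod_pos fun i _ => by positivity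
  set s := Real.log (v / P) with hs
  set B := (M - μ * Real.log ε - (μ - ε) / n * s) / ε with hB
  refine ⟨Real.exp (s - (n - 1) * B) / n, by positivity, Real.exp B, fun Q hQ hsymQ hvol hM => ?_⟩
  have hsym : ∀ x ∈ Q, -x ∈ Q := fun x hx => by rw [hsymQ]; simpa using hx
  obtain ⟨ρ, hρ, hρQ⟩ := hQ.exists_closedBall_subset hsymQ
  obtain ⟨e, a, horth, hmem, hbox, hmax, -⟩ :=
    exists_inscribed_frame hQ.1 hQ.2.1 hsym hρ hρQ n (by simp)
  have ha : ∀ i < n, 0 < a i := fun i hi => (hmem i hi).1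
  have hmem' : ∀ i < n, a i • e i ∈ Q := fun i hi => (hmem i hi).2
  have he : Orthonormal ℝ fun i : Fin n => e i := by
    rw [orthonormal_iff_ite]
    intro i j
    simp [horth i i.2 j j.2, Fin.ext_iff]
  have hanti : ∀ i j, i ≤ j → j < n → a j ≤ a i := by
    intro i j hij hj
    have h1 := hmax i (hij.trans_lt hj) _ (hmem' j hj) fun l hl => by
      rw [real_inner_smul_left, horth j hj l (by omega), if_neg (by omega), mul_zero]
    rwa [norm_smul, Real.norm_of_nonneg (ha j hj).le, he.1 ⟨j, hj⟩, mul_one] at h1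
  have hmain := le_logFunc_of_frame hn hνsupp hQ.1 hsym hρ hρQ he ha hmem' hanti hε0 hεn
    (hslab _ he)
  rw [← hμ] at hmain
  set S := ∑ k ∈ Finset.range n, Real.log (a k) with hS
  have hsS : s ≤ S := by
    have h1 := volume_toReal_le_of_forall_abs_inner_le he (c := fun i => 2 ^ (i : ℕ) * a i)
      (fun i => mul_nonneg (by positivity) (ha i i.2).le) fun x hx i => hbox i i.2 x hx
    rw [Fin.prod_univ_eq_prod_range (fun i => 2 * (2 ^ i * a i))] at h1
    simp only [← mul_assoc] at h1
    rw [Finset.prod_mul_distrib] at h1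
    rw [hs, hS, ← Real.log_prod fun i hi => (ha i (Finset.mem_range.1 hi)).ne']
    refine Real.log_le_log (by positivity) ?_
    rw [div_le_iff₀ hPpos, mul_comm]
    exact hvol.trans h1
  have hlog : ∀ i j, i ≤ j → j < n → Real.log (a j) ≤ Real.log (a i) := fun i j hij hj =>
    Real.log_le_log (ha j hj) (hanti i j hij hj)
  have hlast : Real.log (a (n - 1)) ≤ S / n := by
    rw [le_div_iff₀ hn0, mul_comm, hS]
    have := Finset.card_nsmul_le_sum (Finset.range n) (fun k => Real.log (a k))
      (Real.log (a (n - 1))) fun k hk => hlog k (n - 1)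
        (by have := Finset.mem_range.1 hk; omega) (by omega)
    simpa using this
  have h0 : Real.log (a 0) ≤ B := by
    rw [hB, le_div_iff₀ hε0]
    have h1 : ε * Real.log (a (n - 1)) ≤ ε * (S / n) := mul_le_mul_of_nonneg_left hlast hε0.le
    have h2 : (μ - ε) / n * s ≤ (μ - ε) / n * S :=
      mul_le_mul_of_nonneg_left hsS (div_nonneg (sub_nonneg.2 hεμ) hn0.le)
    have h3 : (μ - ε) / n * S = μ / n * S - ε * (S / n) := by ring
    linarith
  have hlast' : s - (n - 1) * B ≤ Real.log (a (n - 1)) := by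
    have h1 : S = ∑ k ∈ Finset.range (n - 1), Real.log (a k) + Real.log (a (n - 1)) := by
      rw [hS, ← Finset.sum_range_succ, Nat.sub_add_cancel (by omega)]
    have h2 := Finset.sum_le_card_nsmul (Finset.range (n - 1)) (fun k => Real.log (a k)) B
      fun k hk => (hlog 0 k (Nat.zero_le _) (by have := Finset.mem_range.1 hk; omega)).trans h0
    rw [Finset.card_range, nsmul_eq_mul, Nat.cast_sub (by omega), Nat.cast_one] at h2
    linarith
  constructor
  · refine closedBall_subset_of_orthonormal (by omega) he hQ.2.1 hsym (a := fun i => a i)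
      (fun i => hmem' i i.2) (fun i => ?_) fun i => ha i i.2
    rw [mul_div_cancel₀ _ hn0.ne', ← Real.le_log_iff_exp_le (ha i i.2)]
    exact hlast'.trans (hlog i (n - 1) (by omega) (by omega))
  · intro x hx
    rw [mem_closedBall_zero_iff]
    refine (hmax 0 (by omega) x hx (by simp)).trans ?_
    exact (Real.log_le_iff_le_exp (ha 0 (by omega))).1 h0

theorem exists_mem_dist_le_dist {E : Type*} [MetricSpace E]
    (K L : TopologicalSpace.NonemptyCompacts E) {x : E} (hx : x ∈ K) :
    ∃ y ∈ L, dist x y ≤ dist K L := by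
  obtain ⟨y, hy, hxy⟩ := L.isCompact.exists_infDist_eq_dist L.nonempty x
  refine ⟨y, hy, hxy ▸ ?_⟩
  exact Metric.infDist_le_hausdorffDist_of_mem hx
    (Metric.hausdorffEDist_ne_top_of_nonempty_of_bounded K.nonempty L.nonempty
      K.isCompact.isBounded L.isCompact.isBounded)

theorem isClosed_setOf_mem_nonemptyCompacts {E : Type*} [MetricSpace E] (x : E) :
    IsClosed {K : TopologicalSpace.NonemptyCompacts E | x ∈ K} := by
  refine isClosed_of_closure_subset fun L hL => ?_
  rw [Metric.mem_closure_iff] at hL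
  have : x ∈ closure (L : Set E) := Metric.mem_closure_iff.2 fun ε hε => by
    obtain ⟨K, hK, hLK⟩ := hL ε hε
    obtain ⟨y, hy, hxy⟩ := exists_mem_dist_le_dist K L hK
    exact ⟨y, hy, by rw [dist_comm] at hLK; linarith⟩
  rwa [L.isCompact.isClosed.closure_eq] at this

theorem isClosed_setOf_convex_nonemptyCompacts {E : Type*} [NormedAddCommGroup E]
    [NormedSpace ℝ E] :
    IsClosed {K : TopologicalSpace.NonemptyCompacts E | Convex ℝ (K : Set E)} := by
  refine isClosed_of_closure_subset fun L hL => ?_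
  rw [Metric.mem_closure_iff] at hL
  intro x hx y hy a b ha hb hab
  have : a • x + b • y ∈ closure (L : Set E) := Metric.mem_closure_iff.2 fun ε hε => by
    obtain ⟨K, hK, hLK⟩ := hL (ε / 2) (half_pos hε)
    obtain ⟨x', hx', hxx⟩ := exists_mem_dist_le_dist L K hx
    obtain ⟨y', hy', hyy⟩ := exists_mem_dist_le_dist L K hy
    obtain ⟨w, hw, hzw⟩ := exists_mem_dist_le_dist K L (hK hx' hy' ha hb hab)
    refine ⟨w, hw, ?_⟩
    have h1 : dist (a • x + b • y) (a • x' + b • y') ≤ dist L K :=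
      calc dist (a • x + b • y) (a • x' + b • y')
          ≤ dist (a • x) (a • x') + dist (b • y) (b • y') := dist_add_add_le _ _ _ _
        _ = a * dist x x' + b * dist y y' := by
          rw [dist_smul₀, dist_smul₀, Real.norm_of_nonneg ha, Real.norm_of_nonneg hb]
        _ ≤ a * dist L K + b * dist L K := by gcongr
        _ = dist L K := by rw [← add_mul, hab, one_mul]
    have h2 := dist_triangle (a • x + b • y) (a • x' + b • y') w
    rw [dist_comm K L] at hzw
    linarith
  rwa [L.isCompact.isClosed.closure_eq] at this

theorem isClosed_setOf_symmetric_nonemptyCompacts {E : Type*} [NormedAddCommGroup E] :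
    IsClosed {K : TopologicalSpace.NonemptyCompacts E | ∀ x ∈ K, -x ∈ K} := by
  refine isClosed_of_closure_subset fun L hL => ?_
  rw [Metric.mem_closure_iff] at hL
  intro x hx
  have : -x ∈ closure (L : Set E) := Metric.mem_closure_iff.2 fun ε hε => by
    obtain ⟨K, hK, hLK⟩ := hL (ε / 2) (half_pos hε)
    obtain ⟨x', hx', hxx⟩ := exists_mem_dist_le_dist L K hx
    obtain ⟨w, hw, hzw⟩ := exists_mem_dist_le_dist K L (hK x' hx')
    refine ⟨w, hw, ?_⟩
    have h1 : dist (-x) (-x') = dist x x' := dist_neg_neg x x'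
    have h2 := dist_triangle (-x) (-x') w
    rw [dist_comm K L] at hzw
    linarith
  rw [L.isCompact.isClosed.closure_eq] at this
  exact this

/-- The symmetric convex bodies lying between two balls centred at the origin. -/
def symmetricBodiesBetween (n : ℕ) (r R : ℝ) :
    Set (TopologicalSpace.NonemptyCompacts (EuclideanSpace ℝ (Fin n))) :=
  {K | (K : Set (EuclideanSpace ℝ (Fin n))) ⊆ Metric.closedBall 0 R} ∩
    ({K | Metric.closedBall 0 r ⊆ (K : Set (EuclideanSpace ℝ (Fin n)))} ∩
      ({K | Convex ℝ (K : Set (EuclideanSpace ℝ (Fin n)))} ∩ {K | ∀ x ∈ K, -x ∈ K}))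

theorem isCompact_symmetricBodiesBetween (n : ℕ) (r R : ℝ) :
    IsCompact (symmetricBodiesBetween n r R) := by
  refine (TopologicalSpace.NonemptyCompacts.isCompact_subsets_of_isCompact
    (isCompact_closedBall 0 R)).inter_right (IsClosed.inter ?_
      (isClosed_setOf_convex_nonemptyCompacts.inter isClosed_setOf_symmetric_nonemptyCompacts))
  simp only [Set.subset_def, Set.ofPred_forall]
  exact isClosed_iInter fun x => isClosed_iInter fun _ => isClosed_setOf_mem_nonemptyCompacts x

theorem isConvexBody_of_mem_symmetricBodiesBetween {n : ℕ} {r R : ℝ} (hr : 0 < r)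
    {K : TopologicalSpace.NonemptyCompacts (EuclideanSpace ℝ (Fin n))}
    (hK : K ∈ symmetricBodiesBetween n r R) : IsConvexBody (K : Set (EuclideanSpace ℝ (Fin n))) :=
  ⟨K.isCompact, hK.2.2.1, 0, interior_mono hK.2.1
    (Metric.ball_subset_interior_closedBall (Metric.mem_ball_self hr))⟩

theorem eq_neg_of_forall_neg_mem {E : Type*} [AddGroup E] {K : Set E}
    (h : ∀ x ∈ K, -x ∈ K) : K = -K := by
  ext x
  exact ⟨h x, fun hx => by simpa using h _ hx⟩

theorem suppFn_le_add_dist {n : ℕ}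
    (K L : TopologicalSpace.NonemptyCompacts (EuclideanSpace ℝ (Fin n)))
    {u : EuclideanSpace ℝ (Fin n)} (hu : u ∈ unitSphere n) :
    suppFn (K : Set (EuclideanSpace ℝ (Fin n))) u ≤ suppFn L u + dist K L := by
  refine csSup_le (K.nonempty.image _) ?_
  rintro _ ⟨x, hx, rfl⟩
  obtain ⟨y, hy, hxy⟩ := exists_mem_dist_le_dist K L hx
  have hu1 : ‖u‖ = 1 := by simpa [unitSphere] using hu
  have h1 := inner_le_suppFn L.isCompact hy u
  have h2 := real_inner_le_norm (x - y) u
  rw [hu1, mul_one, ← dist_eq_norm, inner_sub_left] at h2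
  change ⟪x, u⟫_ℝ ≤ _
  linarith

theorem logFunc_le_add_dist {n : ℕ} {ν : Measure (EuclideanSpace ℝ (Fin n))}
    [IsFiniteMeasure ν] (hνsupp : ν (unitSphere n)ᶜ = 0) {r R : ℝ} (hr : 0 < r)
    {K L : TopologicalSpace.NonemptyCompacts (EuclideanSpace ℝ (Fin n))}
    (hK : K ∈ symmetricBodiesBetween n r R) (hL : L ∈ symmetricBodiesBetween n r R) :
    logFunc ν K ≤ logFunc ν L + ν.real Set.univ / r * dist K L := by
  have hiK := integrable_log_suppFn hνsupp K.isCompact hr hK.2.1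
  have hiL := integrable_log_suppFn hνsupp L.isCompact hr hL.2.1
  have h1 : logFunc ν K ≤ ∫ u, (Real.log (suppFn (L : Set (EuclideanSpace ℝ (Fin n))) u)
      + dist K L / r) ∂ν := by
    refine integral_mono_ae hiK (hiL.add (integrable_const _)) ?_
    have hae : ∀ᵐ u ∂ν, u ∈ unitSphere n := hνsupp
    filter_upwards [hae] with u hu
    have hKr := le_suppFn_of_closedBall_subset K.isCompact hr.le hK.2.1 hu
    have hLr := le_suppFn_of_closedBall_subset L.isCompact hr.le hL.2.1 hu
    have hd := suppFn_le_add_dist K L hu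
    set p := suppFn (K : Set (EuclideanSpace ℝ (Fin n))) u
    set q := suppFn (L : Set (EuclideanSpace ℝ (Fin n))) u
    have hp : 0 < p := hr.trans_le hKr
    have hq : 0 < q := hr.trans_le hLr
    have h2 := Real.log_le_sub_one_of_pos (div_pos hp hq)
    rw [Real.log_div hp.ne' hq.ne'] at h2
    have h3 : p / q - 1 ≤ dist K L / r := by
      rw [div_sub_one hq.ne']
      exact div_le_div₀ dist_nonneg (by linarith) hr hLr
    linarith
  rw [integral_add hiL (integrable_const _), integral_const, smul_eq_mul] at h1
  refine h1.trans_eq ?_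
  rw [logFunc]
  ring

theorem continuousOn_logFunc {n : ℕ} {ν : Measure (EuclideanSpace ℝ (Fin n))}
    [IsFiniteMeasure ν] (hνsupp : ν (unitSphere n)ᶜ = 0) {r R : ℝ} (hr : 0 < r) :
    ContinuousOn (fun K : TopologicalSpace.NonemptyCompacts (EuclideanSpace ℝ (Fin n)) =>
      logFunc ν (K : Set (EuclideanSpace ℝ (Fin n)))) (symmetricBodiesBetween n r R) := by
  have hLip : LipschitzOnWith (ν.real Set.univ / r).toNNReal
      (fun K : TopologicalSpace.NonemptyCompacts (EuclideanSpace ℝ (Fin n)) =>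
        logFunc ν (K : Set (EuclideanSpace ℝ (Fin n)))) (symmetricBodiesBetween n r R) := by
    refine LipschitzOnWith.of_le_add_mul _ fun K hK L hL => ?_
    rw [Real.coe_toNNReal _ (by positivity)]
    exact logFunc_le_add_dist hνsupp hr hK hL
  exact hLip.continuousOn

theorem continuousOn_of_tendsto_hausdorffDist {n : ℕ} {F : Set (EuclideanSpace ℝ (Fin n)) → ℝ}
    (hFcont : ∀ (K : ℕ → Set (EuclideanSpace ℝ (Fin n))) (L),
      (∀ i, IsConvexBody (K i)) → IsConvexBody L →
      Tendsto (fun i => Metric.hausdorffDist (K i) L) atTop (𝓝 0) →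
      Tendsto (fun i => F (K i)) atTop (𝓝 (F L))) {r R : ℝ} (hr : 0 < r) :
    ContinuousOn (fun K : TopologicalSpace.NonemptyCompacts (EuclideanSpace ℝ (Fin n)) =>
      F (K : Set (EuclideanSpace ℝ (Fin n)))) (symmetricBodiesBetween n r R) := by
  rw [continuousOn_iff_continuous_domRestrict, continuous_iff_seqContinuous]
  intro K L hKL
  refine hFcont (fun i => (K i).1) L.1
    (fun i => isConvexBody_of_mem_symmetricBodiesBetween hr (K i).2)
    (isConvexBody_of_mem_symmetricBodiesBetween hr L.2) ?_
  exact tendsto_iff_dist_tendsto_zero.1 hKL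

theorem isConvexBody_closedBall {n : ℕ} {t : ℝ} (ht : 0 < t) :
    IsConvexBody (Metric.closedBall (0 : EuclideanSpace ℝ (Fin n)) t) :=
  ⟨isCompact_closedBall 0 t, convex_closedBall 0 t, 0,
    Metric.ball_subset_interior_closedBall (Metric.mem_ball_self ht)⟩

/-- under the strict subspace concentration inequality, the infimum of
`Φ_ν` over origin-symmetric convex bodies `Q` with `F(Q) = ν(S^{n-1})` is attained. -/
theorem log_minkowski_minimizer_exists (n : ℕ) (hn : 2 ≤ n)
    (ν : Measure (EuclideanSpace ℝ (Fin n))) [IsFiniteMeasure ν]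
    (hνsupp : ν (unitSphere n)ᶜ = 0)
    (hνeven : ν.map (fun x => -x) = ν)
    (hνpos : 0 < ν (unitSphere n))
    (hνscc : ∀ H : Submodule ℝ (EuclideanSpace ℝ (Fin n)),
      0 < Module.finrank ℝ H → Module.finrank ℝ H < n →
      ν ((H : Set (EuclideanSpace ℝ (Fin n))) ∩ unitSphere n)
        < ((Module.finrank ℝ H : ℝ≥0∞) / (n : ℝ≥0∞)) * ν (unitSphere n))
    (α : ℝ) (hα : α ≠ 0)
    (F : Set (EuclideanSpace ℝ (Fin n)) → ℝ)
    (hFpos : ∀ K, IsConvexBody K → 0 < F K)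
    (hFcont : ∀ (K : ℕ → Set (EuclideanSpace ℝ (Fin n))) (L),
      (∀ i, IsConvexBody (K i)) → IsConvexBody L →
      Tendsto (fun i => Metric.hausdorffDist (K i) L) atTop (𝓝 0) →
      Tendsto (fun i => F (K i)) atTop (𝓝 (F L)))
    (hFhom : ∀ K, IsConvexBody K → ∀ t : ℝ, 0 < t → F (t • K) = t ^ α * F K)
    -- property (A): monotonicity
    (hA : ∀ K L, IsConvexBody K → IsConvexBody L → K ⊆ L →
      Real.sign α * F K ≤ Real.sign α * F L)
    -- property (B): isoperimetric-type control by the volume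
    (hB : ∃ C : ℝ, 0 < C ∧ ∀ K, IsConvexBody K →
      (F K) ^ (1 / α) ≤ C * (volume K).toReal ^ (1 / (n : ℝ))) :
    ∃ K₀, IsConvexBody K₀ ∧ K₀ = -K₀ ∧ F K₀ = (ν (unitSphere n)).toReal ∧
      ∀ Q, IsConvexBody Q → Q = -Q → F Q = (ν (unitSphere n)).toReal →
        logFunc ν K₀ ≤ logFunc ν Q := by
  have hμ : 0 < (ν (unitSphere n)).toReal := ENNReal.toReal_pos hνpos.ne' (measure_ne_top _ _)
  set μ := (ν (unitSphere n)).toReal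
  have hn0 : n ≠ 0 := by omega
  obtain ⟨C, hC, hFC⟩ := hB
  have hvol : ∀ Q, IsConvexBody Q → F Q = μ → (μ ^ (1 / α) / C) ^ n ≤ (volume Q).toReal := by
    intro Q hQ hFQ
    have h1 := hFC Q hQ
    rw [hFQ, ← div_le_iff₀' hC] at h1
    calc (μ ^ (1 / α) / C) ^ n ≤ ((volume Q).toReal ^ (1 / (n : ℝ))) ^ n :=
          pow_le_pow_left₀ (by positivity) h1 n
      _ = (volume Q).toReal := by
          rw [one_div, Real.rpow_inv_natCast_pow ENNReal.toReal_nonneg hn0]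
  have hF1 := hFpos _ (isConvexBody_closedBall (n := n) one_pos)
  set t := (μ / F (Metric.closedBall 0 1)) ^ (1 / α)
  have ht : 0 < t := by positivity
  set Q₀ : Set (EuclideanSpace ℝ (Fin n)) := Metric.closedBall 0 t with hQ₀
  have hQ₀body : IsConvexBody Q₀ := isConvexBody_closedBall ht
  have hQ₀sym : Q₀ = -Q₀ := by simp [hQ₀]
  have hQ₀F : F Q₀ = μ := by
    have h1 := hFhom _ (isConvexBody_closedBall (n := n) one_pos) t ht
    rw [smul_closedBall _ _ zero_le_one, smul_zero, mul_one, Real.norm_of_nonneg ht.le,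
      ← Real.rpow_mul (by positivity), one_div_mul_cancel hα, Real.rpow_one,
      div_mul_cancel₀ _ hF1.ne'] at h1
    exact h1
  obtain ⟨r, hr, R, hrR⟩ := exists_closedBall_subset_subset_closedBall hn hνsupp hνpos hνscc
    (v := (μ ^ (1 / α) / C) ^ n) (by positivity) (logFunc ν Q₀)
  have hmem : ∀ (Q : Set (EuclideanSpace ℝ (Fin n))) (hQ : IsConvexBody Q), Q = -Q → F Q = μ →
      logFunc ν Q ≤ logFunc ν Q₀ →
      (⟨⟨Q, hQ.1⟩, hQ.2.2.mono interior_subset⟩ :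
        TopologicalSpace.NonemptyCompacts (EuclideanSpace ℝ (Fin n)))
        ∈ symmetricBodiesBetween n r R := by
    intro Q hQ hsym hFQ hle
    obtain ⟨h1, h2⟩ := hrR Q hQ hsym (hvol Q hQ hFQ) hle
    refine ⟨h2, h1, hQ.2.1, fun x hx => ?_⟩
    have hxQ : x ∈ Q := hx
    change -x ∈ Q
    rw [hsym]
    simpa using hxQ
  have hcompact : IsCompact (symmetricBodiesBetween n r R ∩ {K | F K = μ}) :=
    (isCompact_symmetricBodiesBetween n r R).of_isClosed_subset
      ((continuousOn_of_tendsto_hausdorffDist hFcont hr).preimage_isClosed_of_isClosed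
        (isCompact_symmetricBodiesBetween n r R).isClosed (isClosed_singleton (x := μ)))
      Set.inter_subset_left
  obtain ⟨K, ⟨hK, hKF⟩, hKmin⟩ := hcompact.exists_isMinOn
    ⟨_, hmem Q₀ hQ₀body hQ₀sym hQ₀F le_rfl, hQ₀F⟩
    ((continuousOn_logFunc hνsupp hr).mono Set.inter_subset_left)
  refine ⟨K, isConvexBody_of_mem_symmetricBodiesBetween hr hK,
    eq_neg_of_forall_neg_mem hK.2.2.2, hKF, fun Q hQ hsym hFQ => ?_⟩
  rcases le_total (logFunc ν Q) (logFunc ν Q₀) with h | h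
  · exact hKmin ⟨hmem Q hQ hsym hFQ h, hFQ⟩
  · exact (hKmin ⟨hmem Q₀ hQ₀body hQ₀sym hQ₀F le_rfl, hQ₀F⟩).trans h
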